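/- Let Q ∈ ℝ[X] be a polynomial of degree at most 3 such that G_2(x) = x^4·G_2(T(x)) − π^2·x^2·log(x) + Q(x) + 6·∫_0^x t^2·(x−2t)·G_2(T(t)) dt holds for all x ∈ (0,1). Then for every irrational x ∈ (0,1): G_2(x) = π^2·∑_{k=0}^∞ β_{k−1}(x)·β_k(x)^2·γ_k(x) + ∑_{k=0}^∞ Q(T^k(x))·β_{k−1}(x)^4 + 6·∑_{k=0}^∞ β_{k−1}(x)^4·∫_0^{T^k(x)} t^2·(T^k(x)−2t)·G_2(T(t)) dt, and all three series converge absolutely. -/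

import Mathlib

open Real

noncomputable section

/-- The sum-of-divisors function `σ₁(n) = ∑_{d ∣ n} d`. -/
def sigma1 (n : ℕ) : ℕ := ∑ d ∈ n.divisors, d

/-- `G₂(x) = ∑_{n=1}^∞ σ₁(n)/n³ · cos(2πnx)`. -/
def G2 (x : ℝ) : ℝ :=
  ∑' n : ℕ, (sigma1 (n + 1) : ℝ) / ((n : ℝ) + 1) ^ 3 * Real.cos (2 * π * ((n : ℝ) + 1) * x)

/-- The Gauss map: `T 0 = 0` and `T y = 1/y mod 1` otherwise. -/
def gauss (y : ℝ) : ℝ := if y = 0 then 0 else Int.fract y⁻¹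

/-- `betaCF x k = β_{k−1}(x) = ∏_{j=0}^{k−1} T^j(x)`; in particular `betaCF x 0 = β_{−1} = 1`. -/
def betaCF (x : ℝ) (k : ℕ) : ℝ := ∏ j ∈ Finset.range k, gauss^[j] x

/-- `γ_k(x) = β_{k−1}(x) · log(1/T^k(x))`. -/
def gammaCF (x : ℝ) (k : ℕ) : ℝ := betaCF x k * Real.log (gauss^[k] x)⁻¹

theorem sigma1_le (n : ℕ) (hn : 0 < n) : (sigma1 n : ℝ) ≤ n * (2 * (n : ℝ) ^ (1 / 2 : ℝ) + 1) := by
  have h1 : (sigma1 n : ℝ) ≤ n * (harmonic n : ℝ) := by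
    have h2 : (sigma1 n : ℝ) = ∑ d ∈ n.divisors, (n : ℝ) * (d : ℝ)⁻¹ := by
      rw [sigma1, ← Nat.sum_div_divisors]
      push_cast
      refine Finset.sum_congr rfl fun d hd => ?_
      have hd' := Nat.dvd_of_mem_divisors hd
      rw [Nat.cast_div hd' (by exact_mod_cast (Nat.pos_of_dvd_of_pos hd' hn).ne'), div_eq_mul_inv]
    rw [h2, ← Finset.mul_sum, harmonic_eq_sum_Icc]
    push_cast
    gcongr
    intro d hd
    exact Finset.mem_Icc.2 ⟨Nat.pos_of_mem_divisors hd, Nat.divisor_le hd⟩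
  have h3 := harmonic_le_one_add_log n
  have h4 := Real.log_le_rpow_div (Nat.cast_nonneg n) (show (0 : ℝ) < 1 / 2 by norm_num)
  refine h1.trans ?_
  gcongr
  linarith

theorem summable_sigma1_div_cube :
    Summable fun n : ℕ => (sigma1 (n + 1) : ℝ) / ((n : ℝ) + 1) ^ 3 := by
  have h : Summable fun n : ℕ => 3 * (1 / (n : ℝ) ^ (3 / 2 : ℝ)) :=
    (Real.summable_one_div_nat_rpow.2 (by norm_num)).mul_left 3
  refine Summable.of_nonneg_of_le (fun n => by positivity) (fun n => ?_)
    ((summable_nat_add_iff 1).2 h)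
  have hn : (1 : ℝ) ≤ ((n + 1 : ℕ) : ℝ) := by push_cast; linarith [n.cast_nonneg (α := ℝ)]
  have h1 := sigma1_le (n + 1) n.succ_pos
  rw [← Nat.cast_succ]
  simp only [Nat.succ_eq_add_one]
  set m : ℝ := ((n + 1 : ℕ) : ℝ)
  have hm : 0 < m := by linarith
  have h2 : 1 ≤ m ^ (1 / 2 : ℝ) := Real.one_le_rpow hn (by norm_num)
  have h3 : m ^ (3 : ℕ) = m * m ^ (1 / 2 : ℝ) * m ^ (3 / 2 : ℝ) := by
    rw [mul_assoc, ← Real.rpow_add hm]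
    norm_num
    ring
  rw [mul_one_div, h3, div_le_div_iff₀ (by positivity) (by positivity)]
  have h4 : (sigma1 (n + 1) : ℝ) ≤ 3 * (m * m ^ (1 / 2 : ℝ)) := h1.trans (by nlinarith)
  calc _ ≤ 3 * (m * m ^ (1 / 2 : ℝ)) * m ^ (3 / 2 : ℝ) := by gcongr
    _ = _ := by ring

theorem exists_abs_G2_le : ∃ M, 0 ≤ M ∧ ∀ x, |G2 x| ≤ M := by
  refine ⟨∑' n : ℕ, (sigma1 (n + 1) : ℝ) / ((n : ℝ) + 1) ^ 3,
    tsum_nonneg fun n => by positivity, fun x => ?_⟩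
  rw [G2, ← Real.norm_eq_abs]
  refine tsum_of_norm_bounded summable_sigma1_div_cube.hasSum fun n => ?_
  rw [norm_mul, Real.norm_of_nonneg (by positivity)]
  exact mul_le_of_le_one_right (by positivity) (Real.abs_cos_le_one _)

theorem gauss_mem_Ioo_of_irrational {x : ℝ} (h : Irrational x) :
    gauss x ∈ Set.Ioo (0 : ℝ) 1 ∧ Irrational (gauss x) := by
  have h1 : Irrational (gauss x) := by
    rw [gauss, if_neg h.ne_zero, Int.fract]
    exact h.inv.sub_intCast _
  refine ⟨⟨lt_of_le_of_ne ?_ h1.ne_zero.symm, ?_⟩, h1⟩ <;> rw [gauss, if_neg h.ne_zero]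
  · exact Int.fract_nonneg _
  · exact Int.fract_lt_one _

theorem gauss_iterate_mem_Ioo {x : ℝ} (hx : x ∈ Set.Ioo (0 : ℝ) 1) (h : Irrational x) (k : ℕ) :
    gauss^[k] x ∈ Set.Ioo (0 : ℝ) 1 ∧ Irrational (gauss^[k] x) := by
  induction k with
  | zero => exact ⟨hx, h⟩
  | succ k ih =>
    rw [Function.iterate_succ_apply']
    exact gauss_mem_Ioo_of_irrational ih.2

theorem mul_gauss_le_half {x : ℝ} (hx : x ∈ Set.Ioo (0 : ℝ) 1) : x * gauss x ≤ 1 / 2 := by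
  obtain ⟨h0, h1⟩ := hx
  rw [gauss, if_neg h0.ne']
  have h2 : (1 : ℝ) ≤ ⌊x⁻¹⌋ := by
    exact_mod_cast Int.le_floor.2 (by simpa using (one_le_inv₀ h0).2 h1.le)
  have h3 : x * Int.fract x⁻¹ = 1 - x * ⌊x⁻¹⌋ := by
    rw [Int.fract, mul_sub, mul_inv_cancel₀ h0.ne']
  have h4 := Int.fract_lt_one x⁻¹
  nlinarith

theorem betaCF_succ (x : ℝ) (k : ℕ) : betaCF x (k + 1) = betaCF x k * gauss^[k] x :=
  Finset.prod_range_succ _ _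

theorem betaCF_pos {x : ℝ} (hx : x ∈ Set.Ioo (0 : ℝ) 1) (h : Irrational x) (k : ℕ) :
    0 < betaCF x k :=
  Finset.prod_pos fun j _ => (gauss_iterate_mem_Ioo hx h j).1.1

theorem betaCF_le_one {x : ℝ} (hx : x ∈ Set.Ioo (0 : ℝ) 1) (h : Irrational x) (k : ℕ) :
    betaCF x k ≤ 1 :=
  Finset.prod_le_one (fun j _ => (gauss_iterate_mem_Ioo hx h j).1.1.le)
    fun j _ => (gauss_iterate_mem_Ioo hx h j).1.2.le

theorem betaCF_le_geometric {x : ℝ} (hx : x ∈ Set.Ioo (0 : ℝ) 1) (h : Irrational x) (k : ℕ) :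
    betaCF x k ≤ 2 * (3 / 4) ^ k := by
  induction k using Nat.twoStepInduction with
  | zero => simp [betaCF]
  | one => exact (betaCF_le_one hx h 1).trans (by norm_num)
  | more k ih _ =>
    have h1 := mul_gauss_le_half (gauss_iterate_mem_Ioo hx h k).1
    have h2 : betaCF x (k + 2) = betaCF x k * (gauss^[k] x * gauss (gauss^[k] x)) := by
      rw [betaCF_succ, betaCF_succ, Function.iterate_succ_apply', mul_assoc]
    have h3 : (0 : ℝ) < (3 / 4) ^ k := by positivity
    rw [h2, pow_add]
    nlinarith [mul_le_mul_of_nonneg_left h1 (betaCF_pos hx h k).le]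

theorem summable_betaCF_pow_four {x : ℝ} (hx : x ∈ Set.Ioo (0 : ℝ) 1) (h : Irrational x) :
    Summable fun k => betaCF x k ^ 4 := by
  refine Summable.of_nonneg_of_le (fun k => pow_nonneg (betaCF_pos hx h k).le 4) (fun k => ?_)
    ((summable_geometric_of_lt_one (r := (3 / 4 : ℝ)) (by norm_num) (by norm_num)).mul_left 2)
  exact (pow_le_of_le_one (betaCF_pos hx h k).le (betaCF_le_one hx h k) (by norm_num)).trans
    (betaCF_le_geometric hx h k)

theorem summable_abs_mul_betaCF_pow_four {x : ℝ} (hx : x ∈ Set.Ioo (0 : ℝ) 1)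
    (h : Irrational x) {f : ℕ → ℝ} {C : ℝ} (hf : ∀ k, |f k| ≤ C) :
    Summable fun k => |f k * betaCF x k ^ 4| := by
  refine Summable.of_nonneg_of_le (fun k => abs_nonneg _) (fun k => ?_)
    ((summable_betaCF_pow_four hx h).mul_left C)
  have h1 := pow_nonneg (betaCF_pos hx h k).le 4
  rw [abs_mul, abs_of_nonneg h1]
  exact mul_le_mul_of_nonneg_right (hf k) h1

theorem betaCF_log_term_eq (x : ℝ) (k : ℕ) :
    betaCF x k * betaCF x (k + 1) ^ 2 * gammaCF x k
      = -(gauss^[k] x ^ 2 * Real.log (gauss^[k] x)) * betaCF x k ^ 4 := by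
  rw [gammaCF, betaCF_succ, Real.log_inv]
  ring

/-- Iterating the functional equation of `G₂`: if `Q` is a polynomial of degree ≤ 3 with
`G₂(x) = x⁴G₂(T x) − π²x² log x + Q(x) + 6∫₀ˣ t²(x−2t)G₂(T t) dt` on `(0,1)`, then for
every irrational `x ∈ (0,1)` the three series below converge absolutely and
`G₂(x) = π²∑ β_{k−1}β_k² γ_k + ∑ Q(T^k x) β_{k−1}⁴
  + 6∑ β_{k−1}⁴ ∫₀^{T^k x} t²(T^k x − 2t) G₂(T t) dt`. -/
theorem G2_iterated_functional_equation (Q : Polynomial ℝ) (hdeg : Q.degree ≤ 3)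
    (hfe : ∀ x ∈ Set.Ioo (0 : ℝ) 1,
      G2 x = x ^ 4 * G2 (gauss x) - π ^ 2 * x ^ 2 * Real.log x + Q.eval x
        + 6 * ∫ t in (0 : ℝ)..x, t ^ 2 * (x - 2 * t) * G2 (gauss t)) :
    ∀ x ∈ Set.Ioo (0 : ℝ) 1, Irrational x →
      (Summable fun k : ℕ =>
        |betaCF x k * betaCF x (k + 1) ^ 2 * gammaCF x k|) ∧
      (Summable fun k : ℕ =>
        |Q.eval (gauss^[k] x) * betaCF x k ^ 4|) ∧
      (Summable fun k : ℕ =>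
        |betaCF x k ^ 4 *
          ∫ t in (0 : ℝ)..(gauss^[k] x), t ^ 2 * (gauss^[k] x - 2 * t) * G2 (gauss t)|) ∧
      G2 x =
        π ^ 2 * ∑' k : ℕ, betaCF x k * betaCF x (k + 1) ^ 2 * gammaCF x k
          + ∑' k : ℕ, Q.eval (gauss^[k] x) * betaCF x k ^ 4
          + 6 * ∑' k : ℕ, betaCF x k ^ 4 *
              ∫ t in (0 : ℝ)..(gauss^[k] x), t ^ 2 * (gauss^[k] x - 2 * t) * G2 (gauss t) := by
  intro x hx hirr
  obtain ⟨M, hM0, hM⟩ := exists_abs_G2_le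
  have hmem k := (gauss_iterate_mem_Ioo hx hirr k).1
  have hA : Summable fun k : ℕ => |betaCF x k * betaCF x (k + 1) ^ 2 * gammaCF x k| := by
    simp_rw [betaCF_log_term_eq]
    refine summable_abs_mul_betaCF_pow_four hx hirr (C := 1) fun k => ?_
    obtain ⟨h0, h1⟩ := hmem k
    have h2 := (Real.abs_log_mul_self_lt _ h0 h1.le).le
    rw [abs_neg, show gauss^[k] x ^ 2 * Real.log (gauss^[k] x)
      = gauss^[k] x * (Real.log (gauss^[k] x) * gauss^[k] x) by ring, abs_mul, abs_of_pos h0]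
    exact mul_le_one₀ h1.le (abs_nonneg _) h2
  have hB : Summable fun k : ℕ => |Q.eval (gauss^[k] x) * betaCF x k ^ 4| := by
    obtain ⟨C, hC⟩ := (isCompact_Icc (a := (0 : ℝ)) (b := 1)).exists_bound_of_continuousOn
      Q.continuous.continuousOn
    exact summable_abs_mul_betaCF_pow_four hx hirr fun k => hC _ (Set.Ioo_subset_Icc_self (hmem k))
  have hC : Summable fun k : ℕ => |betaCF x k ^ 4 *
      ∫ t in (0 : ℝ)..(gauss^[k] x), t ^ 2 * (gauss^[k] x - 2 * t) * G2 (gauss t)| := by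
    simp_rw [mul_comm (betaCF x _ ^ 4)]
    refine summable_abs_mul_betaCF_pow_four hx hirr (C := M) fun k => ?_
    obtain ⟨h0, h1⟩ := hmem k
    refine (intervalIntegral.norm_integral_le_of_norm_le_const (C := M)
      (f := fun t => t ^ 2 * (gauss^[k] x - 2 * t) * G2 (gauss t)) fun t ht => ?_).trans ?_
    · rw [Set.uIoc_of_le h0.le] at ht
      obtain ⟨ht0, ht1⟩ := ht
      have h2 : |t ^ 2 * (gauss^[k] x - 2 * t)| ≤ 1 := by
        rw [abs_mul, abs_of_nonneg (sq_nonneg t)]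
        exact mul_le_one₀ (pow_le_one₀ ht0.le (ht1.trans h1.le)) (abs_nonneg _)
          (abs_le.2 ⟨by linarith, by linarith⟩)
      rw [norm_mul]
      exact (mul_le_mul h2 (hM _) (abs_nonneg _) zero_le_one).trans_eq (one_mul M)
    · rw [sub_zero, abs_of_pos h0]
      exact mul_le_of_le_one_right hM0 h1.le
  refine ⟨hA, hB, hC, ?_⟩
  have hsum := ((hA.of_abs.hasSum.mul_left (π ^ 2)).add hB.of_abs.hasSum).add
    (hC.of_abs.hasSum.mul_left 6)
  have hpartial (N : ℕ) : ∑ k ∈ Finset.range N,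
      (π ^ 2 * (betaCF x k * betaCF x (k + 1) ^ 2 * gammaCF x k)
        + Q.eval (gauss^[k] x) * betaCF x k ^ 4
        + 6 * (betaCF x k ^ 4 *
          ∫ t in (0 : ℝ)..(gauss^[k] x), t ^ 2 * (gauss^[k] x - 2 * t) * G2 (gauss t)))
      = G2 x - G2 (gauss^[N] x) * betaCF x N ^ 4 := by
    induction N with
    | zero => simp [betaCF]
    | succ N ih =>
      rw [Finset.sum_range_succ, ih, hfe _ (hmem N), betaCF_log_term_eq, betaCF_succ,
        Function.iterate_succ_apply']
      ring
  have hrem := (summable_abs_mul_betaCF_pow_four hx hirr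
    (f := fun k => G2 (gauss^[k] x)) fun k => hM _).of_abs.tendsto_atTop_zero
  have hlim := hsum.tendsto_sum_nat
  simp_rw [hpartial] at hlim
  simpa using tendsto_nhds_unique (hrem.const_sub (G2 x)) hlim

end
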